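/- The number of conjugacy classes of stabilizer subgroups for the action of the Weyl group W(C_n) = (ℤ/2)^n ⋊ S_n on the set of elements of (ℝ/ℤ)^n, counted appropriately for the compact group Sp(n), equals Σ_{i=0}^{n} (⌊i/2⌋+1)·p(n−i). -/

import Mathlib

/-!
STATEMENT 10: The number of conjugacy classes of stabilizer subgroups for the action
of the Weyl group `W(C_n) = (ℤ/2)^n ⋊ S_n` on the maximal torus `(ℝ/ℤ)^n` of the
compact group `Sp(n)` (permuting coordinates and negating coordinates) equals
`Σ_{i=0}^{n} (⌊i/2⌋+1)·p(n−i)`, where `p` is the partition function.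
-/

open Pointwise

/-- The sign group `(ℤ/2)^n`, realized multiplicatively as `Fin n → ℤˣ`. -/
abbrev Signs (n : ℕ) := Fin n → ℤˣ

/-- A permutation of `Fin n` acts on `Signs n` by permuting the coordinates. -/
def permAutSigns {n : ℕ} (σ : Equiv.Perm (Fin n)) : MulAut (Signs n) where
  toFun v := v ∘ σ.symm
  invFun v := v ∘ σ
  left_inv v := by funext i; simp
  right_inv v := by funext i; simp
  map_mul' v w := rfl

/-- The action of `S_n` on `(ℤ/2)^n` permuting coordinates, as a homomorphism. -/
def permHom (n : ℕ) : Equiv.Perm (Fin n) →* MulAut (Signs n) where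
  toFun := permAutSigns
  map_one' := MulEquiv.ext fun v => rfl
  map_mul' σ τ := MulEquiv.ext fun v => rfl

/-- The hyperoctahedral group `W(B_n) = (ℤ/2)^n ⋊ S_n`. -/
abbrev WB (n : ℕ) := SemidirectProduct (Signs n) (Equiv.Perm (Fin n)) (permHom n)

/-- `W(B_n)` acts on `M^n` for any additive group `M` (e.g. the torus `(ℝ/ℤ)^n` or the
Cartan subalgebra `k^n`) by permuting the coordinates and negating some of them. -/
instance WBAction {n : ℕ} {M : Type*} [AddCommGroup M] : MulAction (WB n) (Fin n → M) where
  smul w t := fun i => ((w.left i : ℤ)) • t (w.right⁻¹ i)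
  one_smul t := by
    funext i
    show (((1 : WB n).left i : ℤ)) • t ((1 : WB n).right⁻¹ i) = t i
    simp
  mul_smul w w' t := by
    funext i
    show (((w * w').left i : ℤ)) • t ((w * w').right⁻¹ i)
      = ((w.left i : ℤ)) • ((w'.left (w.right⁻¹ i) : ℤ)) • t (w'.right⁻¹ (w.right⁻¹ i))
    rw [SemidirectProduct.mul_left, SemidirectProduct.mul_right]
    simp [permHom, permAutSigns, mul_inv_rev, Units.val_mul, mul_smul, Equiv.Perm.inv_def]

/-- The product-of-signs character of `W(B_n)`. -/
def signProd (n : ℕ) : WB n →* ℤˣ where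
  toFun w := ∏ i, w.left i
  map_one' := by simp
  map_mul' w w' := by
    show (∏ i, (w * w').left i) = _
    rw [SemidirectProduct.mul_left]
    show (∏ i, w.left i * w'.left (w.right.symm i)) = _
    rw [Finset.prod_mul_distrib]
    congr 1
    exact Equiv.prod_comp w.right.symm w'.left

/-- The Weyl group `W(D_n) = (ℤ/2)^{n-1} ⋊ S_n` of even sign changes. -/
abbrev WD (n : ℕ) : Subgroup (WB n) := (signProd n).ker

section Action

variable {n : ℕ} {M : Type*} [AddCommGroup M]

lemma WB_smul_apply (w : WB n) (t : Fin n → M) (i : Fin n) :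
    (w • t) i = ((w.left i : ℤ)) • t (w.right⁻¹ i) := rfl

/-- The class of the stabilizer of a point, up to conjugacy. -/
def stabilizerClass (t : Fin n → M) :
    Quotient (MulAction.orbitRel (ConjAct (WB n)) (Subgroup (WB n))) :=
  Quotient.mk _ (MulAction.stabilizer (WB n) t)

/-- The signed transposition of the coordinates `i` and `j`. -/
def signedSwap (i j : Fin n) (ε : ℤˣ) : WB n where
  left := fun k => if k = i ∨ k = j then ε else 1
  right := Equiv.swap i j

lemma signedSwap_mem_stabilizer (t : Fin n → M) (i j : Fin n) (ε : ℤˣ) :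
    signedSwap i j ε ∈ MulAction.stabilizer (WB n) t ↔ t i = (ε : ℤ) • t j := by
  rw [MulAction.mem_stabilizer_iff]
  constructor
  · intro h
    have := congrFun h i
    rw [WB_smul_apply] at this
    simpa [signedSwap] using this.symm
  · intro h
    have h' : t j = (ε : ℤ) • t i := by
      rw [h, smul_smul, ← Units.val_mul, Int.units_mul_self]; simp
    funext k
    rw [WB_smul_apply]
    by_cases hi : k = i
    · subst hi; simpa [signedSwap] using h.symm
    · by_cases hj : k = j
      · subst hj; simpa [signedSwap] using h'.symm
      · simp [signedSwap, hi, hj, Equiv.swap_apply_of_ne_of_ne hi hj]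

lemma stabilizer_eq_iff {M' : Type*} [AddCommGroup M'] (t : Fin n → M) (t' : Fin n → M') :
    MulAction.stabilizer (WB n) t = MulAction.stabilizer (WB n) t' ↔
      ∀ i j (ε : ℤˣ), t i = (ε : ℤ) • t j ↔ t' i = (ε : ℤ) • t' j := by
  constructor
  · intro h i j ε
    rw [← signedSwap_mem_stabilizer, h, signedSwap_mem_stabilizer]
  · intro h
    ext w
    simp only [MulAction.mem_stabilizer_iff, funext_iff, WB_smul_apply]
    refine forall_congr' fun i => ?_
    rw [eq_comm, h, eq_comm]

lemma stabilizerClass_eq_iff (t t' : Fin n → M) :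
    stabilizerClass t = stabilizerClass t' ↔
      ∃ w : WB n, MulAction.stabilizer (WB n) (w • t) = MulAction.stabilizer (WB n) t' := by
  rw [eq_comm, stabilizerClass, stabilizerClass, Quotient.eq, MulAction.orbitRel_apply,
    MulAction.mem_orbit_iff]
  constructor
  · rintro ⟨w, hw⟩
    refine ⟨ConjAct.ofConjAct w, ?_⟩
    rw [← hw, MulAction.stabilizer_smul_eq_stabilizer_map_conj]
    rfl
  · rintro ⟨w, hw⟩
    refine ⟨ConjAct.toConjAct w, ?_⟩
    rw [← hw, MulAction.stabilizer_smul_eq_stabilizer_map_conj]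
    rfl

lemma stabilizerClass_smul (w : WB n) (t : Fin n → M) :
    stabilizerClass (w • t) = stabilizerClass t :=
  ((stabilizerClass_eq_iff _ _).2 ⟨w, rfl⟩).symm

lemma stabilizerClass_comp_perm (σ : Equiv.Perm (Fin n)) (t : Fin n → M) :
    stabilizerClass (t ∘ σ) = stabilizerClass t := by
  rw [← stabilizerClass_smul (⟨1, σ⁻¹⟩ : WB n) t]
  congr 1
  funext i
  rw [WB_smul_apply]
  simp

end Action

section Normalization

variable (M : Type*) [AddCommGroup M]

/-- Equality up to sign. -/
def signSetoid : Setoid M where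
  r a b := a = b ∨ a = -b
  iseqv :=
    { refl := fun _ => Or.inl rfl
      symm := by
        rintro a b (rfl | rfl)
        · exact Or.inl rfl
        · exact Or.inr (neg_neg b).symm
      trans := by
        rintro a b c (rfl | rfl) (rfl | rfl) <;> simp }

variable {M}

/-- A chosen representative of `a` up to sign. -/
noncomputable def signRep (a : M) : M := (Quotient.mk (signSetoid M) a).out

lemma signRep_eq_or (a : M) : signRep a = a ∨ signRep a = -a :=
  Quotient.mk_out (s := signSetoid M) a

lemma signRep_eq_iff {a b : M} : signRep a = signRep b ↔ a = b ∨ a = -b :=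
  Quotient.out_inj.trans (Quotient.eq (r := signSetoid M))

lemma signRep_signRep (a : M) : signRep (signRep a) = signRep a :=
  signRep_eq_iff.2 (signRep_eq_or a)

lemma signRep_add_self_eq_zero {a : M} : signRep a + signRep a = 0 ↔ a + a = 0 := by
  rcases signRep_eq_or a with h | h <;> rw [h]
  rw [← neg_add, neg_eq_zero]

lemma eq_neg_iff_of_signRep {a b : M} (ha : signRep a = a) (hb : signRep b = b) :
    a = -b ↔ a = b ∧ a + a = 0 := by
  constructor
  · intro h
    have hab : a = b := by rw [← ha, ← hb]; exact signRep_eq_iff.2 (Or.inr h)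
    subst hab
    exact ⟨rfl, eq_neg_iff_add_eq_zero.1 h⟩
  · rintro ⟨rfl, h⟩
    exact eq_neg_iff_add_eq_zero.2 h

lemma stabilizerClass_signRep {n : ℕ} (t : Fin n → M) :
    stabilizerClass (signRep ∘ t) = stabilizerClass t := by
  have h : ∀ i, ∃ ε : ℤˣ, signRep (t i) = (ε : ℤ) • t i := by
    intro i
    rcases signRep_eq_or (t i) with h | h
    · exact ⟨1, by simp [h]⟩
    · exact ⟨-1, by simp [h]⟩
  choose ε hε using h
  rw [← stabilizerClass_smul (⟨ε, 1⟩ : WB n) t]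
  congr 1
  funext i
  rw [WB_smul_apply]
  simp [hε]

/-- Stabilizers are conjugate exactly when, up to a permutation of the coordinates, the two points
have the same coincidences up to sign and the same coordinates of order dividing two. -/
lemma stabilizerClass_eq_iff_exists_perm {n : ℕ} (t t' : Fin n → M) :
    stabilizerClass t = stabilizerClass t' ↔ ∃ σ : Equiv.Perm (Fin n),
      (∀ i j, signRep (t i) = signRep (t j) ↔ signRep (t' (σ i)) = signRep (t' (σ j))) ∧
      ∀ i, signRep (t i) + signRep (t i) = 0 ↔ signRep (t' (σ i)) + signRep (t' (σ i)) = 0 := by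
  constructor
  · intro h
    obtain ⟨w, hw⟩ := (stabilizerClass_eq_iff _ _).1 h.symm
    rw [stabilizer_eq_iff] at hw
    have hr : ∀ i, signRep ((w • t') i) = signRep (t' (w.right⁻¹ i)) := by
      intro i
      rw [signRep_eq_iff, WB_smul_apply]
      rcases Int.units_eq_one_or (w.left i) with h | h <;> simp [h]
    refine ⟨w.right⁻¹, fun i j => ?_, fun i => ?_⟩
    · rw [← hr, ← hr, signRep_eq_iff, signRep_eq_iff]
      have h1 := hw i j 1
      have h2 := hw i j (-1)
      simp only [Units.val_one, one_smul, Units.val_neg, neg_smul] at h1 h2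
      rw [h1, h2]
    · rw [← hr, signRep_add_self_eq_zero, signRep_add_self_eq_zero]
      have h2 := hw i i (-1)
      simp only [Units.val_one, one_smul, Units.val_neg, neg_smul] at h2
      rw [← eq_neg_iff_add_eq_zero, ← eq_neg_iff_add_eq_zero, h2]
  · rintro ⟨σ, h1, h2⟩
    rw [← stabilizerClass_signRep t, ← stabilizerClass_signRep t',
      ← stabilizerClass_comp_perm σ (signRep ∘ t'), stabilizerClass_eq_iff]
    refine ⟨1, ?_⟩
    rw [one_smul, stabilizer_eq_iff]
    intro i j ε
    rcases Int.units_eq_one_or ε with rfl | rfl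
    · simpa using h1 i j
    · simp only [Units.val_one, one_smul, Units.val_neg, neg_smul, Function.comp_apply]
      rw [eq_neg_iff_of_signRep (signRep_signRep _) (signRep_signRep _),
        eq_neg_iff_of_signRep (signRep_signRep _) (signRep_signRep _), h1, h2]

end Normalization

section FiberSizes

variable {α β I J : Type*} [Fintype α] [Fintype β]

open Classical in
/-- The multiset of sizes of the nonempty fibers of `κ` over points satisfying `p`. -/
noncomputable def fiberSizes (κ : α → I) (p : I → Prop) : Multiset ℕ :=
  ((Finset.univ.image κ).filter p).val.map fun a => (Finset.univ.filter fun i => κ i = a).card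

lemma fiberSizes_eq [DecidableEq I] (κ : α → I) (p : I → Prop) [DecidablePred p] :
    fiberSizes κ p = ((Finset.univ.image κ).filter p).val.map
      fun a => (Finset.univ.filter fun i => κ i = a).card := by
  unfold fiberSizes
  congr!

lemma fiberSizes_congr {κ : α → I} {κ' : β → J} {p : I → Prop} {q : J → Prop} (σ : α ≃ β)
    (h : ∀ i j, κ i = κ j ↔ κ' (σ i) = κ' (σ j)) (hp : ∀ i, p (κ i) ↔ q (κ' (σ i))) :
    fiberSizes κ p = fiberSizes κ' q := by
  classical
  unfold fiberSizes
  have key : ∀ a ∈ (Finset.univ.image κ).filter p, ∃ i, κ i = a := by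
    intro a ha
    simpa using (Finset.mem_filter.1 ha).1
  choose s hs using key
  refine Multiset.map_eq_map_of_bij_of_nodup _ _ (Finset.nodup _) (Finset.nodup _)
    (fun a ha => κ' (σ (s a ha))) ?_ ?_ ?_ ?_
  · intro a ha
    have := (Finset.mem_filter.1 ha).2
    refine Finset.mem_filter.2 ⟨by simp, ?_⟩
    rw [← hp, hs]
    exact this
  · intro a ha b hb hab
    rw [← h, hs, hs] at hab
    exact hab
  · intro b hb
    obtain ⟨hb1, hb2⟩ := Finset.mem_filter.1 hb
    obtain ⟨j, -, rfl⟩ := Finset.mem_image.1 hb1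
    have hmem : κ (σ.symm j) ∈ (Finset.univ.image κ).filter p :=
      Finset.mem_filter.2 ⟨by simp, by rw [hp]; simpa using hb2⟩
    refine ⟨κ (σ.symm j), hmem, ?_⟩
    have := (h (s _ hmem) (σ.symm j)).1 (hs _ hmem)
    simpa using this
  · intro a ha
    refine Finset.card_equiv σ fun i => ?_
    simp only [Finset.mem_filter, Finset.mem_univ, true_and]
    rw [← h, hs]

lemma count_fiberSizes [DecidableEq I] (κ : α → I) (p : I → Prop) (m : ℕ) :
    (fiberSizes κ p).count m =
      Nat.card {a : Finset.univ.image κ // p a ∧ (Finset.univ.filter fun i => κ i = a).card = m} := by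
  classical
  rw [fiberSizes_eq, Multiset.count_map, ← Finset.filter_val, Finset.card_val,
    Nat.card_congr (Equiv.subtypeSubtypeEquivSubtypeInter (· ∈ Finset.univ.image κ)
      fun a => p a ∧ (Finset.univ.filter fun i => κ i = a).card = m)]
  symm
  apply Nat.subtype_card
  intro a
  simp only [Finset.mem_filter, and_assoc, @eq_comm _ m]

lemma exists_equiv_of_fiberSizes_eq {κ : α → I} {κ' : β → J} {p : I → Prop} {q : J → Prop}
    (h1 : fiberSizes κ p = fiberSizes κ' q)
    (h2 : fiberSizes κ (fun a => ¬ p a) = fiberSizes κ' (fun a => ¬ q a)) :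
    ∃ σ : α ≃ β, (∀ i j, κ i = κ j ↔ κ' (σ i) = κ' (σ j)) ∧ ∀ i, p (κ i) ↔ q (κ' (σ i)) := by
  classical
  let f : Finset.univ.image κ → Bool × ℕ :=
    fun a => (decide (p a), (Finset.univ.filter fun i => κ i = a).card)
  let g : Finset.univ.image κ' → Bool × ℕ :=
    fun a => (decide (q a), (Finset.univ.filter fun i => κ' i = a).card)
  have hf : ∀ c, Nonempty ({a // f a = c} ≃ {b // g b = c}) := by
    rintro ⟨b, m⟩
    refine ⟨Fintype.equivOfCardEq ?_⟩
    have h1' := congrArg (Multiset.count m) h1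
    have h2' := congrArg (Multiset.count m) h2
    simp only [count_fiberSizes, Nat.card_eq_fintype_card] at h1' h2'
    cases b
    · simpa [f, g] using h2'
    · simpa [f, g] using h1'
  let E := fun c => (hf c).some
  let e : Finset.univ.image κ ≃ Finset.univ.image κ' := Equiv.ofFiberEquiv E
  have he : ∀ a, g (e a) = f a := Equiv.ofFiberEquiv_map E
  let k : α → Finset.univ.image κ' := fun i => e ⟨κ i, by simp⟩
  let k' : β → Finset.univ.image κ' := fun i => ⟨κ' i, by simp⟩
  have hk : ∀ c, Nonempty ({a // k a = c} ≃ {b // k' b = c}) := by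
    intro c
    obtain ⟨a, rfl⟩ := e.surjective c
    refine ⟨Fintype.equivOfCardEq ?_⟩
    rw [Fintype.card_subtype, Fintype.card_subtype]
    have := congrArg Prod.snd (he a)
    simp only [f, g] at this
    simp only [k, k', Subtype.ext_iff, e.injective.eq_iff]
    exact this.symm
  let S := fun c => (hk c).some
  have hS : ∀ i, k' (Equiv.ofFiberEquiv S i) = k i := Equiv.ofFiberEquiv_map S
  refine ⟨Equiv.ofFiberEquiv S, fun i j => ?_, fun i => ?_⟩
  · have : κ' (Equiv.ofFiberEquiv S i) = κ' (Equiv.ofFiberEquiv S j) ↔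
        k' (Equiv.ofFiberEquiv S i) = k' (Equiv.ofFiberEquiv S j) := by
      simp [k']
    rw [this, hS, hS]
    simp only [k, e.injective.eq_iff, Subtype.mk.injEq]
  · have h := congrArg Prod.fst (he ⟨κ i, by simp⟩)
    simp only [f, g, decide_eq_decide] at h
    have h' : κ' (Equiv.ofFiberEquiv S i) = (e ⟨κ i, by simp⟩ : Finset.univ.image κ').1 :=
      congrArg Subtype.val (hS i)
    rw [h', h]

lemma zero_notMem_fiberSizes (κ : α → I) (p : I → Prop) : 0 ∉ fiberSizes κ p := by
  classical
  unfold fiberSizes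
  simp only [Multiset.mem_map, not_exists, not_and]
  intro a ha h0
  obtain ⟨i, -, hi⟩ := Finset.mem_image.1 (Finset.mem_filter.1 ha).1
  have := Finset.card_eq_zero.1 h0
  exact Finset.notMem_empty i (this ▸ by simp [hi])

lemma sum_fiberSizes_add (κ : α → I) (p : I → Prop) :
    (fiberSizes κ p).sum + (fiberSizes κ fun a => ¬ p a).sum = Fintype.card α := by
  classical
  rw [fiberSizes_eq, fiberSizes_eq]
  have := Finset.sum_filter_add_sum_filter_not (Finset.univ.image κ) p
    fun a => (Finset.univ.filter fun i => κ i = a).card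
  rw [← Finset.card_eq_sum_card_image, Finset.card_univ] at this
  rw [← this]
  rfl

lemma fiberSizes_of_surjective {A : Type*} [Fintype A] [DecidableEq I] {κ : α → I}
    (hκ : Function.Surjective κ) {p : I → Prop} (ι : A ↪ I) (hι : ∀ c, p c ↔ ∃ a, ι a = c) :
    fiberSizes κ p =
      Finset.univ.val.map fun a => (Finset.univ.filter fun i => κ i = ι a).card := by
  classical
  have h : (Finset.univ.image κ).filter p = Finset.univ.map ι := by
    ext c
    simp [hι, hκ c]
  rw [fiberSizes_eq, h, Finset.map_val, Multiset.map_map]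
  rfl

lemma fiberSizes_sigma_fst {A : Type*} [Fintype A] [Fintype I] {s : I → ℕ} (hs : ∀ c, s c ≠ 0)
    {p : I → Prop} (ι : A ↪ I) (hι : ∀ c, p c ↔ ∃ a, ι a = c) :
    fiberSizes (Sigma.fst : (Σ c, Fin (s c)) → I) p = Finset.univ.val.map (s ∘ ι) := by
  classical
  have hsurj : Function.Surjective (Sigma.fst : (Σ c, Fin (s c)) → I) :=
    fun c => ⟨⟨c, ⟨0, Nat.pos_of_ne_zero (hs c)⟩⟩, rfl⟩
  rw [fiberSizes_of_surjective hsurj ι hι]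
  refine Multiset.map_congr rfl fun a _ => ?_
  rw [← Fintype.card_subtype, Fintype.card_congr (Equiv.sigmaSubtype (ι a)), Fintype.card_fin]
  rfl

end FiberSizes

section Torus

lemma addCircle_add_self_eq_zero_iff (a : AddCircle (1 : ℝ)) :
    a + a = 0 ↔ a = 0 ∨ a = ((1 / 2 : ℝ) : AddCircle (1 : ℝ)) := by
  constructor
  · induction a using QuotientAddGroup.induction_on with
    | H x =>
      intro h
      rw [← AddCircle.coe_add, AddCircle.coe_eq_zero_iff] at h
      obtain ⟨m, hm⟩ := h
      rw [zsmul_eq_mul, mul_one] at hm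
      rcases Int.even_or_odd' m with ⟨k, rfl | rfl⟩
      · left
        refine (AddCircle.coe_eq_zero_iff 1).2 ⟨k, ?_⟩
        push_cast at hm
        simp only [zsmul_eq_mul, mul_one]
        linarith
      · right
        rw [← sub_eq_zero, ← AddCircle.coe_sub, AddCircle.coe_eq_zero_iff]
        refine ⟨k, ?_⟩
        push_cast at hm
        simp only [zsmul_eq_mul, mul_one]
        linarith
  · rintro (rfl | rfl)
    · simp
    · rw [← AddCircle.coe_add, AddCircle.coe_eq_zero_iff]
      exact ⟨1, by norm_num⟩

lemma addCircle_coe_ne_zero {x : ℝ} (h0 : 0 < x) (h1 : x < 1) :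
    (x : AddCircle (1 : ℝ)) ≠ 0 := by
  intro h
  obtain ⟨m, hm⟩ := (AddCircle.coe_eq_zero_iff 1).1 h
  rw [zsmul_eq_mul, mul_one] at hm
  rw [← hm] at h0 h1
  have h0' : 0 < m := by exact_mod_cast h0
  have h1' : m < 1 := by exact_mod_cast h1
  omega

lemma signRep_coe_injOn {x y : ℝ} (hx : 0 < x) (hx' : x < 1 / 2) (hy : 0 < y) (hy' : y < 1 / 2)
    (h : signRep (x : AddCircle (1 : ℝ)) = signRep (y : AddCircle (1 : ℝ))) : x = y := by
  rcases signRep_eq_iff.1 h with h | h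
  · rw [← sub_eq_zero, ← AddCircle.coe_sub] at h
    rcases lt_trichotomy x y with hlt | heq | hlt
    · rw [← neg_eq_zero, ← AddCircle.coe_neg] at h
      exact absurd h (addCircle_coe_ne_zero (by linarith) (by linarith))
    · exact heq
    · exact absurd h (addCircle_coe_ne_zero (by linarith) (by linarith))
  · rw [eq_neg_iff_add_eq_zero, ← AddCircle.coe_add] at h
    exact absurd h (addCircle_coe_ne_zero (by linarith) (by linarith))

/-- Points of the circle pairwise distinct up to sign, the left ones having order dividing two and
the right ones not. -/
lemma exists_signRep_label {A B : Type*} (eA : A ↪ Fin 2) (eB : B ↪ ℕ) :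
    ∃ l : A ⊕ B → AddCircle (1 : ℝ), (∀ c d, signRep (l c) = signRep (l d) ↔ c = d) ∧
      ∀ c, l c + l c = 0 ↔ c.isLeft = true := by
  let x : A → ℝ := fun a => if eA a = 0 then 0 else 1 / 2
  let y : B → ℝ := fun b => 1 / ((eB b : ℝ) + 3)
  have hy : ∀ b, 0 < y b ∧ y b < 1 / 2 := by
    intro b
    have : (0 : ℝ) ≤ eB b := Nat.cast_nonneg _
    exact ⟨by positivity, one_div_lt_one_div_of_lt (by norm_num) (by linarith)⟩
  let l : A ⊕ B → AddCircle (1 : ℝ) := Sum.elim (fun a => (x a : AddCircle (1 : ℝ))) fun b => y b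
  have hl : ∀ c, l c + l c = 0 ↔ c.isLeft = true := by
    rintro (a | b)
    · simp only [Sum.isLeft_inl, iff_true]
      rw [addCircle_add_self_eq_zero_iff]
      by_cases h : eA a = 0 <;> simp [l, x, h]
    · have := hy b
      simp only [Sum.isLeft_inr, Bool.false_eq_true, iff_false, l, Sum.elim_inr]
      rw [← AddCircle.coe_add]
      exact addCircle_coe_ne_zero (by linarith) (by linarith)
  have hl' : ∀ c d, signRep (l c) = signRep (l d) → c.isLeft = d.isLeft := by
    intro c d h
    rw [Bool.eq_iff_iff, ← hl, ← hl, ← signRep_add_self_eq_zero, h, signRep_add_self_eq_zero]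
  refine ⟨l, fun c d => ⟨fun h => ?_, fun h => h ▸ rfl⟩, hl⟩
  have hcd := hl' c d h
  rcases c with a | b <;> rcases d with a' | b'
  · have hhalf : ((1 / 2 : ℝ) : AddCircle (1 : ℝ)) ≠ 0 :=
      addCircle_coe_ne_zero (by norm_num) (by norm_num)
    have h2 : l (Sum.inl a) = l (Sum.inl a') := by
      have h3 := (hl (Sum.inl a')).2 rfl
      rcases signRep_eq_iff.1 h with h | h
      · exact h
      · rw [h]
        exact (eq_neg_iff_add_eq_zero.2 h3).symm
    congr 1
    apply eA.injective
    simp only [l, x, Sum.elim_inl] at h2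
    by_cases h0 : eA a = 0 <;> by_cases h1 : eA a' = 0
    · rw [h0, h1]
    · rw [if_pos h0, if_neg h1] at h2
      exact absurd h2.symm hhalf
    · rw [if_neg h0, if_pos h1] at h2
      exact absurd h2 hhalf
    · omega
  · simp at hcd
  · simp at hcd
  · have := signRep_coe_injOn (hy b).1 (hy b).2 (hy b').1 (hy b').2 h
    congr 1
    apply eB.injective
    simp only [y, one_div, inv_inj, add_left_inj] at this
    exact_mod_cast this

end Torus

section Genus

/-- The sizes of the coordinate classes up to sign of a point of the torus: first the classes of
order dividing two, then the others. -/
noncomputable def torusType {n : ℕ} (t : Fin n → AddCircle (1 : ℝ)) :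
    Multiset ℕ × Multiset ℕ :=
  (fiberSizes (signRep ∘ t) fun a => a + a = 0, fiberSizes (signRep ∘ t) fun a => ¬ a + a = 0)

/-- The possible types of points of the torus. -/
def IsTorusType (n : ℕ) (x : Multiset ℕ × Multiset ℕ) : Prop :=
  (0 ∉ x.1 ∧ x.1.card ≤ 2) ∧ 0 ∉ x.2 ∧ x.1.sum + x.2.sum = n

lemma stabilizerClass_eq_iff_torusType {n : ℕ} (t t' : Fin n → AddCircle (1 : ℝ)) :
    stabilizerClass t = stabilizerClass t' ↔ torusType t = torusType t' := by
  rw [stabilizerClass_eq_iff_exists_perm, torusType, torusType, Prod.mk.injEq]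
  constructor
  · rintro ⟨σ, h1, h2⟩
    exact ⟨fiberSizes_congr σ h1 h2, fiberSizes_congr σ h1 fun i => not_congr (h2 i)⟩
  · rintro ⟨h1, h2⟩
    exact exists_equiv_of_fiberSizes_eq h1 h2

lemma isTorusType_torusType {n : ℕ} (t : Fin n → AddCircle (1 : ℝ)) :
    IsTorusType n (torusType t) := by
  classical
  refine ⟨⟨zero_notMem_fiberSizes (signRep ∘ t) _, ?_⟩,
    zero_notMem_fiberSizes (signRep ∘ t) _, ?_⟩
  · rw [torusType, fiberSizes_eq, Multiset.card_map, Finset.card_val]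
    refine (Finset.card_le_card (t := {0, ((1 / 2 : ℝ) : AddCircle (1 : ℝ))}) ?_).trans
      Finset.card_le_two
    intro a ha
    simpa using (addCircle_add_self_eq_zero_iff a).1 (Finset.mem_filter.1 ha).2
  · rw [torusType, sum_fiberSizes_add, Fintype.card_fin]

lemma IsTorusType.exists_torusType {n : ℕ} {x : Multiset ℕ × Multiset ℕ} (hx : IsTorusType n x) :
    ∃ t : Fin n → AddCircle (1 : ℝ), torusType t = x := by
  classical
  obtain ⟨P, L⟩ := x
  obtain ⟨⟨hP, hcard⟩, hL, hsum⟩ := hx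
  simp only at hP hcard hL hsum
  obtain ⟨vP, hPmap⟩ : ∃ v : P → ℕ, Finset.univ.val.map v = P := ⟨_, Multiset.map_univ_coe P⟩
  obtain ⟨vL, hLmap⟩ : ∃ v : L → ℕ, Finset.univ.val.map v = L := ⟨_, Multiset.map_univ_coe L⟩
  have hvP : ∀ c, vP c ∈ P := fun c =>
    Multiset.subset_of_le hPmap.le (Multiset.mem_map_of_mem _ (Finset.mem_univ c))
  have hvL : ∀ c, vL c ∈ L := fun c =>
    Multiset.subset_of_le hLmap.le (Multiset.mem_map_of_mem _ (Finset.mem_univ c))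
  let s : P ⊕ L → ℕ := Sum.elim vP vL
  have hs : ∀ c, s c ≠ 0 := by
    rintro (c | c)
    · exact fun h => hP (h ▸ hvP c)
    · exact fun h => hL (h ▸ hvL c)
  have eP : Nonempty (P ↪ Fin 2) := by
    rw [Function.Embedding.nonempty_iff_card_le, Multiset.card_coe, Fintype.card_fin]
    exact hcard
  let eL : L ↪ ℕ := (Fintype.equivFin L).toEmbedding.trans Fin.valEmbedding
  obtain ⟨l, hl1, hl2⟩ := exists_signRep_label eP.some eL
  have hn : Fintype.card (Σ c, Fin (s c)) = Fintype.card (Fin n) := by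
    rw [Fintype.card_sigma, Fintype.card_fin, ← hsum, ← congrArg Multiset.sum hPmap,
      ← congrArg Multiset.sum hLmap]
    simp only [Fintype.card_fin]
    exact Fintype.sum_sum_type s
  let e := Fintype.equivOfCardEq hn
  refine ⟨fun i => l (e.symm i).1, ?_⟩
  have h1 : ∀ i j : Σ c, Fin (s c), i.1 = j.1 ↔
      (signRep ∘ fun i => l (e.symm i).1) (e i) = (signRep ∘ fun i => l (e.symm i).1) (e j) := by
    intro i j
    simp [hl1]
  have h2 : ∀ i : Σ c, Fin (s c), i.1.isLeft = true ↔
      (signRep ∘ fun i => l (e.symm i).1) (e i) + (signRep ∘ fun i => l (e.symm i).1) (e i) = 0 := by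
    intro i
    simp only [Function.comp_apply, signRep_add_self_eq_zero, hl2, Equiv.symm_apply_apply]
  rw [torusType, Prod.mk.injEq]
  constructor
  · rw [← fiberSizes_congr (p := fun c => c.isLeft = true) e h1 h2,
      fiberSizes_sigma_fst hs Function.Embedding.inl (by rintro (c | c) <;> simp)]
    exact hPmap
  · rw [← fiberSizes_congr (p := fun c => ¬ c.isLeft = true) e h1 fun i => not_congr (h2 i),
      fiberSizes_sigma_fst hs Function.Embedding.inr (by rintro (c | c) <;> simp)]
    exact hLmap

/-- The multiset of nonzero elements among `k` and `i - k`. -/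
def pairParts (i k : ℕ) : Multiset ℕ :=
  if k = 0 then (if i = 0 then 0 else {i}) else {k, i - k}

lemma sum_pairParts {i k : ℕ} (h : k ≤ i / 2) : (pairParts i k).sum = i := by
  unfold pairParts
  split_ifs with h1 h2 <;> simp <;> omega

lemma zero_notMem_pairParts {i k : ℕ} (h : k ≤ i / 2) : 0 ∉ pairParts i k := by
  unfold pairParts
  split_ifs with h1 h2 <;> simp <;> omega

lemma card_pairParts_le (i k : ℕ) : (pairParts i k).card ≤ 2 := by
  unfold pairParts
  split_ifs <;> simp

lemma pairParts_injective {i k k' : ℕ} (h : k ≤ i / 2) (h' : k' ≤ i / 2)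
    (heq : pairParts i k = pairParts i k') : k = k' := by
  have hc := congrArg Multiset.card heq
  have hk : k ∈ pairParts i k ↔ k ∈ pairParts i k' := by rw [heq]
  unfold pairParts at hc hk
  split_ifs at hc hk <;> simp at hc hk <;> omega

lemma exists_pairParts {P : Multiset ℕ} (hP : 0 ∉ P) (hcard : P.card ≤ 2) :
    ∃ k ≤ P.sum / 2, pairParts P.sum k = P := by
  obtain h | h | h : P.card = 0 ∨ P.card = 1 ∨ P.card = 2 := by omega
  · obtain rfl := Multiset.card_eq_zero.1 h
    exact ⟨0, by simp, by simp [pairParts]⟩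
  · obtain ⟨a, rfl⟩ := Multiset.card_eq_one.1 h
    have : a ≠ 0 := by rintro rfl; simp at hP
    exact ⟨0, by simp, by simp [pairParts, this]⟩
  · obtain ⟨a, b, rfl⟩ := Multiset.card_eq_two.1 h
    have ha : a ≠ 0 := by rintro rfl; simp at hP
    have hb : b ≠ 0 := by rintro rfl; simp at hP
    rcases le_total a b with hab | hab
    · exact ⟨a, by simp; omega, by simp [pairParts, ha]⟩
    · exact ⟨b, by simp; omega, by simpa [pairParts, hb] using Multiset.pair_comm b a⟩

lemma card_isTorusType (n : ℕ) :
    Nat.card {x : Multiset ℕ × Multiset ℕ // IsTorusType n x} =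
      ∑ i ∈ Finset.range (n + 1), (i / 2 + 1) * Fintype.card (Nat.Partition (n - i)) := by
  let F : (Σ i : Fin (n + 1), Fin (i / 2 + 1) × Nat.Partition (n - i)) →
      {x : Multiset ℕ × Multiset ℕ // IsTorusType n x} := fun y =>
    ⟨(pairParts y.1 y.2.1, y.2.2.parts),
      ⟨zero_notMem_pairParts (by have := y.2.1.2; omega), card_pairParts_le _ _⟩,
      fun h => absurd (y.2.2.parts_pos h) (lt_irrefl 0), by
        have h1 := y.1.2
        have h2 := sum_pairParts (i := y.1) (k := y.2.1) (by have := y.2.1.2; omega)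
        have h3 := y.2.2.parts_sum
        simp only
        omega⟩
  have hF : Function.Bijective F := by
    constructor
    · rintro ⟨i, k, L⟩ ⟨i', k', L'⟩ h
      have h1 : pairParts i k = pairParts i' k' := congrArg (fun z => z.1.1) h
      have h2 : L.parts = L'.parts := congrArg (fun z => z.1.2) h
      have hk : (k : ℕ) ≤ i / 2 := by have := k.2; omega
      have hk' : (k' : ℕ) ≤ i' / 2 := by have := k'.2; omega
      obtain rfl : i = i' := by
        rw [Fin.ext_iff, ← sum_pairParts hk, h1, sum_pairParts hk']
      obtain rfl : k = k' := Fin.ext (pairParts_injective hk hk' h1)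
      obtain rfl : L = L' := Nat.Partition.ext h2
      rfl
    · rintro ⟨⟨P, L⟩, ⟨hP, hcard⟩, hL, hsum⟩
      simp only at hP hcard hL hsum
      obtain ⟨k, hk, hPk⟩ := exists_pairParts hP hcard
      refine ⟨⟨⟨P.sum, by omega⟩, ⟨k, by simp only; omega⟩, ⟨L, ?_, by simp only; omega⟩⟩, ?_⟩
      · exact fun {i} hi => Nat.pos_of_ne_zero fun h => hL (h ▸ hi)
      · exact Subtype.ext (Prod.ext hPk rfl)
  rw [← Nat.card_eq_of_bijective F hF, Nat.card_eq_fintype_card, Fintype.card_sigma]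
  simp only [Fintype.card_prod, Fintype.card_fin]
  exact Fin.sum_univ_eq_sum_range
    (fun i => (i / 2 + 1) * Fintype.card (Nat.Partition (n - i))) (n + 1)

end Genus

theorem genus_number_Cn (n : ℕ) :
    Nat.card {C : Quotient (MulAction.orbitRel (ConjAct (WB n)) (Subgroup (WB n))) //
      ∃ t : Fin n → AddCircle (1 : ℝ),
        C = Quotient.mk (MulAction.orbitRel (ConjAct (WB n)) (Subgroup (WB n)))
              (MulAction.stabilizer (WB n) t)} =
    ∑ i ∈ Finset.range (n + 1), (i / 2 + 1) * Fintype.card (Nat.Partition (n - i)) := by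
  rw [← card_isTorusType]
  choose t ht using fun x : {x : Multiset ℕ × Multiset ℕ // IsTorusType n x} =>
    x.2.exists_torusType
  symm
  refine Nat.card_eq_of_bijective (fun x => ⟨stabilizerClass (t x), t x, rfl⟩) ⟨?_, ?_⟩
  · intro x y h
    have h' := (stabilizerClass_eq_iff_torusType _ _).1 (congrArg Subtype.val h)
    rw [ht, ht] at h'
    exact Subtype.ext h'
  · rintro ⟨_, u, rfl⟩
    refine ⟨⟨torusType u, isTorusType_torusType u⟩, Subtype.ext ?_⟩
    exact (stabilizerClass_eq_iff_torusType _ _).2 (ht _)
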